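/- arXiv:2210.02628 — 5 statements merged into one kernel-verified Lean document; each statement's English description precedes it below -/
import Mathlib

section
/- Let X be a pseudometric space, let m ≥ 1 be a natural number, and let v : ZMod (2m) → X be points visited by a closed tour in cyclic index order. Then the cost of the shortcut tour through the even-indexed points satisfies ∑_{i=0}^{m-1} dist(v(2i), v(2i+2)) ≤ ∑_{j ∈ ZMod(2m)} dist(v j, v(j+1)), where index arithmetic is modulo 2m. (The tour T₁ obtained by skipping every other vertex of the single-vehicle tour T costs at most Cost(T).) -/
/-- A sum over `ZMod n` is the sum over the representatives `0, …, n - 1`. -/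
theorem ZMod.sum_eq_sum_range {M : Type*} [AddCommMonoid M] (n : ℕ) [NeZero n] (f : ZMod n → M) :
    ∑ j, f j = ∑ k ∈ Finset.range n, f k := by
  refine Finset.sum_bij' (fun j _ => j.val) (fun k _ => (k : ZMod n)) ?_ ?_ ?_ ?_ ?_
  · exact fun j _ => Finset.mem_range.2 j.val_lt
  · exact fun k _ => Finset.mem_univ _
  · exact fun j _ => ZMod.natCast_zmod_val j
  · exact fun k hk => ZMod.val_cast_of_lt (Finset.mem_range.1 hk)
  · exact fun j _ => by rw [ZMod.natCast_zmod_val]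

/-- A sum over an even range, grouped into consecutive pairs. -/
theorem Finset.sum_range_two_mul_eq_sum_pairs {M : Type*} [AddCommMonoid M] (f : ℕ → M) (m : ℕ) :
    ∑ k ∈ Finset.range (2 * m), f k = ∑ i ∈ Finset.range m, (f (2 * i) + f (2 * i + 1)) := by
  induction m with
  | zero => simp
  | succ m ih =>
    rw [Nat.mul_succ, Finset.sum_range_succ, Finset.sum_range_succ, ih, Finset.sum_range_succ,
      add_assoc]

/-- The shortcut tour through the even-indexed points of a closed
tour `v : ZMod (2m) → X` costs at most the cost of the full tour. -/
theorem shortcut_even_tour_cost_le {X : Type*} [PseudoMetricSpace X]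
    (m : ℕ) [NeZero m] (hm : 1 ≤ m) (v : ZMod (2 * m) → X) :
    ∑ i ∈ Finset.range m, dist (v (2 * i)) (v (2 * i + 2)) ≤
      ∑ j : ZMod (2 * m), dist (v j) (v (j + 1)) := by
  rw [ZMod.sum_eq_sum_range,
    Finset.sum_range_two_mul_eq_sum_pairs (fun k : ℕ => dist (v k) (v (k + 1)))]
  refine Finset.sum_le_sum fun i _ => ?_
  push_cast
  rw [add_assoc (2 * (i : ZMod (2 * m))) 1 1, one_add_one_eq_two]
  exact dist_triangle _ _ _
end

section
/- Let X be a pseudometric space, let m ≥ 1 be a natural number, and let v : ZMod (2m) → X. Then the combined cost of the two shortcut tours, one through the even-indexed points and one through the odd-indexed points, satisfies ∑_{i=0}^{m-1} dist(v(2i), v(2i+2)) + ∑_{i=0}^{m-1} dist(v(2i+1), v(2i+3)) ≤ 2 · ∑_{j ∈ ZMod(2m)} dist(v j, v(j+1)). (Cost(T₁) + Cost(T₂) ≤ 2·Cost(T).) -/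
theorem ZMod.sum_range_natCast {M : Type*} [AddCommMonoid M] (n : ℕ) [NeZero n]
    (f : ZMod n → M) : ∑ k ∈ Finset.range n, f k = ∑ j : ZMod n, f j := by
  refine Finset.sum_bij' (fun k _ => (k : ZMod n)) (fun j _ => j.val) ?_ ?_ ?_ ?_ ?_
  · simp
  · simp [ZMod.val_lt]
  · intro k hk
    exact ZMod.val_cast_of_lt (Finset.mem_range.mp hk)
  · simp
  · simp

theorem Finset.sum_range_even_add_sum_range_odd {M : Type*} [AddCommMonoid M] (f : ℕ → M)
    (m : ℕ) : ∑ i ∈ range m, f (2 * i) + ∑ i ∈ range m, f (2 * i + 1) =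
      ∑ k ∈ range (2 * m), f k := by
  induction m with
  | zero => simp
  | succ m ih =>
    rw [Nat.mul_succ, sum_range_succ f (2 * m + 1), sum_range_succ f (2 * m), ← ih,
      sum_range_succ, sum_range_succ]
    abel

/-- The combined cost of the two shortcut tours (through the
even-indexed and odd-indexed points of the closed tour `v`) is at most twice the
cost of the full tour: `Cost(T₁) + Cost(T₂) ≤ 2·Cost(T)`. -/
theorem shortcut_tours_cost_le_two_mul {X : Type*} [PseudoMetricSpace X]
    (m : ℕ) [NeZero m] (hm : 1 ≤ m) (v : ZMod (2 * m) → X) :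
    ∑ i ∈ Finset.range m, dist (v (2 * i)) (v (2 * i + 2)) +
      ∑ i ∈ Finset.range m, dist (v (2 * i + 1)) (v (2 * i + 3)) ≤
      2 * ∑ j : ZMod (2 * m), dist (v j) (v (j + 1)) := by
  have split : ∑ i ∈ Finset.range m, dist (v (2 * i)) (v (2 * i + 2)) +
      ∑ i ∈ Finset.range m, dist (v (2 * i + 1)) (v (2 * i + 3)) =
      ∑ j : ZMod (2 * m), dist (v j) (v (j + 1 + 1)) := by
    rw [← ZMod.sum_range_natCast, ← Finset.sum_range_even_add_sum_range_odd]
    congr 1 <;> refine Finset.sum_congr rfl fun i _ => ?_ <;> push_cast <;> congr 2 <;> ring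
  have shift : ∑ j : ZMod (2 * m), dist (v (j + 1)) (v (j + 1 + 1)) =
      ∑ j : ZMod (2 * m), dist (v j) (v (j + 1)) :=
    Equiv.sum_comp (Equiv.addRight (1 : ZMod (2 * m))) fun j => dist (v j) (v (j + 1))
  calc _ = ∑ j : ZMod (2 * m), dist (v j) (v (j + 1 + 1)) := split
    _ ≤ ∑ j : ZMod (2 * m), (dist (v j) (v (j + 1)) + dist (v (j + 1)) (v (j + 1 + 1))) :=
      Finset.sum_le_sum fun _ _ => dist_triangle _ _ _
    _ = 2 * ∑ j : ZMod (2 * m), dist (v j) (v (j + 1)) := by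
      rw [Finset.sum_add_distrib, shift, ← two_mul]
end

section
/- Let X be a pseudometric space, let m ≥ 1 be a natural number, and let v : ZMod (2m) → X. Then the total cost of the approximation algorithm's output — the two shortcut tours plus the cheaper set of alternating edges — satisfies ∑_{i=0}^{m-1} dist(v(2i), v(2i+2)) + ∑_{i=0}^{m-1} dist(v(2i+1), v(2i+3)) + min(∑_{i=0}^{m-1} dist(v(2i), v(2i+1)), ∑_{i=0}^{m-1} dist(v(2i+1), v(2i+2))) ≤ (5/2) · ∑_{j ∈ ZMod(2m)} dist(v j, v(j+1)). (Cost(T₁) + Cost(T₂) + Cost(C) ≤ (5/2)·Cost(T).) -/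
/-- A sum over `ZMod n` is a sum over the representatives `0, …, n - 1`. -/
theorem ZMod.sum_univ_eq_sum_range {M : Type*} [AddCommMonoid M] (n : ℕ) [NeZero n]
    (f : ZMod n → M) : ∑ j : ZMod n, f j = ∑ i ∈ Finset.range n, f (i : ZMod n) :=
  Finset.sum_bij' (fun j _ => j.val) (fun i _ => (i : ZMod n))
    (fun j _ => Finset.mem_range.2 j.val_lt) (fun _ _ => Finset.mem_univ _)
    (fun j _ => ZMod.natCast_zmod_val j)
    (fun _ hi => ZMod.val_cast_of_lt (Finset.mem_range.1 hi))
    (fun j _ => by rw [ZMod.natCast_zmod_val])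

/-- A sum over `range (2 * m)` splits into even and odd terms. -/
theorem Finset.sum_range_two_mul_eq_even_add_odd {M : Type*} [AddCommMonoid M] (m : ℕ)
    (f : ℕ → M) : ∑ i ∈ Finset.range (2 * m), f i =
      ∑ i ∈ Finset.range m, (f (2 * i) + f (2 * i + 1)) := by
  induction m with
  | zero => simp
  | succ k ih =>
    rw [Nat.mul_succ, Finset.sum_range_succ, Finset.sum_range_succ, ih,
      Finset.sum_range_succ, add_assoc]

/-- A sum over `ZMod (2 * m)` splits into even and odd terms. -/
theorem ZMod.sum_univ_two_mul {M : Type*} [AddCommMonoid M] (m : ℕ) [NeZero m]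
    (f : ZMod (2 * m) → M) : ∑ j : ZMod (2 * m), f j =
      ∑ i ∈ Finset.range m, (f (2 * i) + f (2 * i + 1)) := by
  rw [ZMod.sum_univ_eq_sum_range,
    Finset.sum_range_two_mul_eq_even_add_odd m (fun i => f (i : ZMod (2 * m)))]
  simp

/-- The total cost of the approximation algorithm's output —
the two shortcut tours plus the cheaper set of alternating edges — satisfies
`Cost(T₁) + Cost(T₂) + Cost(C) ≤ (5/2)·Cost(T)`. -/
theorem approx_output_cost_le {X : Type*} [PseudoMetricSpace X]
    (m : ℕ) [NeZero m] (hm : 1 ≤ m) (v : ZMod (2 * m) → X) :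
    ∑ i ∈ Finset.range m, dist (v (2 * i)) (v (2 * i + 2)) +
      ∑ i ∈ Finset.range m, dist (v (2 * i + 1)) (v (2 * i + 3)) +
      min (∑ i ∈ Finset.range m, dist (v (2 * i)) (v (2 * i + 1)))
          (∑ i ∈ Finset.range m, dist (v (2 * i + 1)) (v (2 * i + 2))) ≤
      (5 / 2) * ∑ j : ZMod (2 * m), dist (v j) (v (j + 1)) := by
  have one_add (x : ZMod (2 * m)) : x + 1 + 1 = x + 2 := by ring
  have two_add (x : ZMod (2 * m)) : x + 2 + 1 = x + 3 := by ring
  have cost_eq := ZMod.sum_univ_two_mul m fun j => dist (v j) (v (j + 1))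
  have shifted_cost_eq := ZMod.sum_univ_two_mul m fun j => dist (v (j + 1)) (v (j + 1 + 1))
  have shift : ∑ j : ZMod (2 * m), dist (v (j + 1)) (v (j + 1 + 1)) =
      ∑ j : ZMod (2 * m), dist (v j) (v (j + 1)) :=
    Equiv.sum_comp (Equiv.addRight (1 : ZMod (2 * m))) fun j => dist (v j) (v (j + 1))
  rw [shift] at shifted_cost_eq
  simp only [one_add, two_add] at cost_eq shifted_cost_eq
  have even_le : ∑ i ∈ Finset.range m, dist (v (2 * i)) (v (2 * i + 2)) ≤
      ∑ j : ZMod (2 * m), dist (v j) (v (j + 1)) := by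
    rw [cost_eq]
    exact Finset.sum_le_sum fun i _ => dist_triangle _ _ _
  have odd_le : ∑ i ∈ Finset.range m, dist (v (2 * i + 1)) (v (2 * i + 3)) ≤
      ∑ j : ZMod (2 * m), dist (v j) (v (j + 1)) := by
    rw [shifted_cost_eq]
    exact Finset.sum_le_sum fun i _ => dist_triangle _ _ _
  rw [Finset.sum_add_distrib] at cost_eq
  have min_le_fst := min_le_left (∑ i ∈ Finset.range m, dist (v (2 * i)) (v (2 * i + 1)))
    (∑ i ∈ Finset.range m, dist (v (2 * i + 1)) (v (2 * i + 2)))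
  have min_le_snd := min_le_right (∑ i ∈ Finset.range m, dist (v (2 * i)) (v (2 * i + 1)))
    (∑ i ∈ Finset.range m, dist (v (2 * i + 1)) (v (2 * i + 2)))
  linarith
end

section
/- Let X be a pseudometric space, let m ≥ 2 be a natural number, and let a, b : Fin m → X. Let p : Fin (2m) → X be the combined enumeration defined by p i = a i for i < m and p i = b (i − m) for i ≥ m, and define TSP*(p) as the minimum over all permutations σ of ZMod (2m) of ∑_{j ∈ ZMod(2m)} dist(p(σ j), p(σ(j+1))). Then the feasible-solution cost satisfies F(a,b) ≥ TSP*(p); that is, the total travel-plus-communication cost of any feasible two-vehicle solution is at least the optimal single-vehicle TSP cost over all 2m targets. -/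
/-- Cost of a feasible two-vehicle solution: both cyclic vehicle tours plus the
communication links `(a i, b i)`. -/
noncomputable def feasibleCost {X : Type*} [PseudoMetricSpace X] {m : ℕ}
    (hm : 2 ≤ m) (a b : Fin m → X) : ℝ :=
  (∑ i : Fin (m - 1), dist (a ⟨i.1, by have := i.2; omega⟩)
      (a ⟨i.1 + 1, by have := i.2; omega⟩)) +
    dist (a ⟨m - 1, by omega⟩) (a ⟨0, by omega⟩) +
  (∑ i : Fin (m - 1), dist (b ⟨i.1, by have := i.2; omega⟩)
      (b ⟨i.1 + 1, by have := i.2; omega⟩)) +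
    dist (b ⟨m - 1, by omega⟩) (b ⟨0, by omega⟩) +
  ∑ i : Fin m, dist (a i) (b i)

/-- `TSP*(p)`: the optimal cyclic single-vehicle tour cost over the points
`p : Fin n → X`, the minimum over all permutations `σ` of `ZMod n` of
`∑_{j ∈ ZMod n} dist(p(σ j), p(σ(j+1)))`. -/
noncomputable def tspStar {X : Type*} [PseudoMetricSpace X] {n : ℕ} [NeZero n]
    (p : Fin n → X) : ℝ :=
  ⨅ σ : Equiv.Perm (ZMod n),
    ∑ j : ZMod n, dist (p ⟨(σ j).val, ZMod.val_lt _⟩)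
      (p ⟨(σ (j + 1)).val, ZMod.val_lt _⟩)

/-- The cost of the tour in which the points are visited in the order `σ`, with `q k` the `k`-th point
visited, bounds the optimal tour cost from above. -/
theorem tspStar_le_sum_range {X : Type*} [PseudoMetricSpace X] {n : ℕ} [NeZero n]
    (p : Fin n → X) (σ : Equiv.Perm (Fin n)) (q : ℕ → X) (hq : ∀ i, p (σ i) = q i) :
    tspStar p ≤ ∑ k ∈ Finset.range (n - 1), dist (q k) (q (k + 1)) + dist (q (n - 1)) (q 0) := by
  obtain _ | k := n
  · exact absurd rfl (NeZero.ne 0)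
  refine (ciInf_le (Set.finite_range _).bddBelow (show Equiv.Perm (ZMod (k + 1)) from σ)).trans ?_
  change ∑ j : Fin (k + 1), dist (p (σ j)) (p (σ (j + 1))) ≤ _
  simp only [hq]
  rw [Fin.sum_univ_castSucc, Finset.sum_range]
  simp

/-- Keeps the first `m` indices and reverses the last `m`. -/
def reverseSecondHalf (m : ℕ) : Equiv.Perm (Fin (2 * m)) :=
  Function.Involutive.toPerm
    (fun i => if h : i.1 < m then i else ⟨3 * m - 1 - i.1, by have := i.2; omega⟩)
    (by
      intro i
      have := i.2
      ext
      dsimp only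
      split_ifs <;> simp_all <;> omega)

/-- For the combined enumeration `p : Fin (2m) → X` of the
targets (`p i = a i` for `i < m` and `p i = b (i - m)` for `i ≥ m`), the cost of
any feasible two-vehicle solution is at least the optimal single-vehicle TSP
cost over all `2m` targets: `F(a,b) ≥ TSP*(p)`. -/
theorem feasibleCost_ge_tspStar {X : Type*} [PseudoMetricSpace X]
    (m : ℕ) [NeZero m] (hm : 2 ≤ m) (a b : Fin m → X) (p : Fin (2 * m) → X)
    (hp1 : ∀ i : Fin (2 * m), ∀ h : i.1 < m, p i = a ⟨i.1, h⟩)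
    (hp2 : ∀ i : Fin (2 * m), ∀ _h : m ≤ i.1, p i = b ⟨i.1 - m, by have := i.2; omega⟩) :
    feasibleCost hm a b ≥ tspStar p := by
  obtain ⟨r, rfl⟩ : ∃ r, m = r + 1 := ⟨m - 1, by omega⟩
  let A : ℕ → X := fun k => a (Fin.ofNat (r + 1) k)
  let B : ℕ → X := fun k => b (Fin.ofNat (r + 1) k)
  have hA : ∀ k (h : k < r + 1), a ⟨k, h⟩ = A k := fun k h => by
    simp [A, Fin.ofNat, Nat.mod_eq_of_lt h]
  have hB : ∀ k (h : k < r + 1), b ⟨k, h⟩ = B k := fun k h => by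
    simp [B, Fin.ofNat, Nat.mod_eq_of_lt h]
  let q : ℕ → X := fun k => if k < r + 1 then A k else B (2 * r + 1 - k)
  have hq : ∀ i, p (reverseSecondHalf (r + 1) i) = q i := by
    intro i
    have hi := i.2
    by_cases h : i.1 < r + 1
    · have hσ : reverseSecondHalf (r + 1) i = i := dif_pos h
      rw [hσ, hp1 i h, hA]
      simp only [q, if_pos h]
    · have hσ : (reverseSecondHalf (r + 1) i).1 = 3 * (r + 1) - 1 - i.1 := 
        congrArg Fin.val (dif_neg h)
      rw [hp2 _ (by omega), hB]
      simp only [q, if_neg h]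
      congr 1
      omega
  have hpathA : ∑ k ∈ Finset.range r, dist (q k) (q (k + 1)) =
      ∑ k ∈ Finset.range r, dist (A k) (A (k + 1)) := by
    refine Finset.sum_congr rfl fun k hk => ?_
    have := Finset.mem_range.1 hk
    simp only [q, if_pos (show k < r + 1 by omega), if_pos (show k + 1 < r + 1 by omega)]
  have hpathB : ∑ k ∈ Finset.range r, dist (q (r + 1 + k)) (q (r + 1 + k + 1)) =
      ∑ k ∈ Finset.range r, dist (B k) (B (k + 1)) := by
    rw [← Finset.sum_range_reflect (fun k => dist (B k) (B (k + 1)))]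
    refine Finset.sum_congr rfl fun k hk => ?_
    have := Finset.mem_range.1 hk
    simp only [q, if_neg (show ¬ r + 1 + k < r + 1 by omega),
      if_neg (show ¬ r + 1 + k + 1 < r + 1 by omega)]
    rw [dist_comm, show 2 * r + 1 - (r + 1 + k + 1) = r - 1 - k by omega,
      show 2 * r + 1 - (r + 1 + k) = r - 1 - k + 1 by omega]
  have hlinks : dist (A 0) (B 0) + dist (A r) (B r) ≤ ∑ i : Fin (r + 1), dist (a i) (b i) := by
    have hne : (⟨0, by omega⟩ : Fin (r + 1)) ≠ ⟨r, by omega⟩ := by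
      simp only [ne_eq, Fin.mk.injEq]
      omega
    rw [← hA 0 (by omega), ← hB 0 (by omega), ← hA r (by omega), ← hB r (by omega),
      ← Finset.sum_pair (f := fun i => dist (a i) (b i)) hne]
    exact Finset.sum_le_sum_of_subset_of_nonneg (Finset.subset_univ _) fun _ _ _ => dist_nonneg
  have htour := tspStar_le_sum_range p _ q hq
  rw [show 2 * (r + 1) - 1 = r + 1 + r by omega, Finset.sum_range_add, Finset.sum_range_succ,
    hpathA, hpathB] at htour
  have hr : q r = A r := by simp [q]
  have hr' : q (r + 1) = B r := by
    simp only [q, lt_irrefl, if_false]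
    congr 1
    omega
  have hlast : q (r + 1 + r) = B 0 := by
    simp only [q, if_neg (show ¬ r + 1 + r < r + 1 by omega)]
    congr 1
    omega
  have hzero : q 0 = A 0 := by simp [q]
  rw [hr, hr', hlast, hzero, dist_comm (B 0)] at htour
  simp only [feasibleCost, hA, hB] at hlinks ⊢
  rw [← Finset.sum_range (fun k => dist (A k) (A (k + 1))),
    ← Finset.sum_range (fun k => dist (B k) (B (k + 1))), Nat.add_sub_cancel]
  linarith [dist_nonneg (x := A r) (y := A 0), dist_nonneg (x := B r) (y := B 0)]
end

section
/- Let V be a type, let m ≥ 1 be a natural number, and let a, b : ZMod m → V be injective maps with disjoint ranges (a t is the t-th target visited by vehicle 1 and b t the t-th target visited by vehicle 2, and they communicate along the links {a t, b t}). For vertices i, l ∈ V, say that (i, j) is a vehicle-1 tour edge iff ∃ t, i = a t ∧ j = a (t+1); that (k, l) is a vehicle-2 tour edge iff ∃ t, k = b t ∧ l = b (t+1); and that an unordered pair {u, w} is a communication link iff ∃ s, {u, w} = {a s, b s}. Then for all i, l ∈ V: there exists j ∈ V such that (i, j) is a vehicle-1 tour edge and {j, l} is a communication link, if and only if there exists k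 ∈ V such that {i, k} is a communication link and (k, l) is a vehicle-2 tour edge. (Lemma 1: the assignment of communication links is consistent with the sequences in which the two vehicles visit their targets.) -/
/-- **Lemma 1.** Vehicle 1 visits the targets `a 0, …, a (m-1)`
cyclically and vehicle 2 visits `b 0, …, b (m-1)` cyclically, where
`a, b : ZMod m → V` are injective with disjoint ranges; at step `s` the two
vehicles communicate along the unordered link `{a s, b s}`.  Then for any
vertices `i, l`: there is a `j` such that `(i, j)` is a vehicle-1 tour edge and
`{j, l}` is a communication link, iff there is a `k` such that `{i, k}` is a
communication link and `(k, l)` is a vehicle-2 tour edge — the assignment of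
communication links is consistent with the sequences in which the two vehicles
visit their targets. -/
theorem comm_links_consistent {V : Type*} (m : ℕ) (hm : 1 ≤ m)
    (a b : ZMod m → V) (ha : Function.Injective a) (hb : Function.Injective b)
    (hdisj : Disjoint (Set.range a) (Set.range b)) :
    ∀ i l : V,
      (∃ j : V, (∃ t : ZMod m, i = a t ∧ j = a (t + 1)) ∧
          ∃ s : ZMod m, ({j, l} : Set V) = {a s, b s}) ↔
      (∃ k : V, (∃ s : ZMod m, ({i, k} : Set V) = {a s, b s}) ∧
          ∃ t : ZMod m, k = b t ∧ l = b (t + 1)) := by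
  have hab : ∀ s t, a s ≠ b t := fun s t h =>
    Set.disjoint_left.mp hdisj ⟨s, rfl⟩ ⟨t, h.symm⟩
  intro i l
  constructor
  · rintro ⟨_, ⟨t, rfl, rfl⟩, s, hs⟩
    rcases Set.pair_eq_pair_iff.mp hs with ⟨h, rfl⟩ | ⟨h, -⟩
    · obtain rfl := ha h
      exact ⟨b t, ⟨t, rfl⟩, t, rfl, rfl⟩
    · exact absurd h (hab _ _)
  · rintro ⟨_, ⟨s, hs⟩, t, rfl, rfl⟩
    rcases Set.pair_eq_pair_iff.mp hs with ⟨rfl, h⟩ | ⟨-, h⟩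
    · obtain rfl := hb h
      exact ⟨a (t + 1), ⟨t, rfl, rfl⟩, t + 1, rfl⟩
    · exact absurd h.symm (hab _ _)
end
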